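/- The entropy photon number N_c(ρ) := g⁻¹(c·H(ρ)), where g(x) = (x+1)log(x+1) − x log x, is a concave function of the density matrix ρ on ℂ^d whenever 0 ≤ c ≤ 1/(d−1). -/

import Mathlib

open Matrix
open scoped ComplexOrder

open scoped Classical in
/-- The von Neumann entropy of a matrix, via its eigenvalues (natural logarithm). -/
noncomputable def vnEntropy {d : ℕ} (ρ : Matrix (Fin d) (Fin d) ℂ) : ℝ :=
  if h : ρ.IsHermitian then ∑ i, Real.negMulLog (h.eigenvalues i) else 0

/-- The function g(x) = (x+1) log(x+1) - x log x. -/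
noncomputable def gfun (x : ℝ) : ℝ := (x + 1) * Real.log (x + 1) - x * Real.log x

namespace EntropyPhotonNumber

/-- The derivative `log (1 + 1 / t)` of `gfun` at `t > 0`. -/
noncomputable def logRatio (t : ℝ) : ℝ := Real.log (t + 1) - Real.log t

theorem logRatio_pos {t : ℝ} (ht : 0 < t) : 0 < logRatio t :=
  sub_pos.2 (Real.log_lt_log ht (by linarith))

theorem exp_logRatio {t : ℝ} (ht : 0 < t) : Real.exp (logRatio t) = (t + 1) / t := by
  rw [logRatio, Real.exp_sub, Real.exp_log (by linarith), Real.exp_log ht]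

theorem exp_neg_logRatio {t : ℝ} (ht : 0 < t) : Real.exp (-logRatio t) = t / (t + 1) := by
  rw [Real.exp_neg, exp_logRatio ht, inv_div]

theorem gfun_eq_log_add (t : ℝ) : gfun t = Real.log (t + 1) + t * logRatio t := by
  rw [gfun, logRatio]; ring

theorem hasDerivAt_logRatio {t : ℝ} (ht : 0 < t) :
    HasDerivAt logRatio (-(1 / (t * (t + 1)))) t := by
  have h1 : HasDerivAt (fun x : ℝ => Real.log (x + 1)) (1 / (t + 1)) t :=
    ((hasDerivAt_id t).add_const 1).log (by simp only [id]; linarith)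
  have h := h1.sub (Real.hasDerivAt_log ht.ne')
  refine h.congr_deriv ?_
  field_simp
  ring

theorem hasDerivAt_gfun {t : ℝ} (ht : 0 < t) : HasDerivAt gfun (logRatio t) t := by
  have h1 : HasDerivAt (fun x : ℝ => Real.log (x + 1)) (1 / (t + 1)) t :=
    ((hasDerivAt_id t).add_const 1).log (by simp only [id]; linarith)
  have h := (h1.add ((hasDerivAt_id t).mul (hasDerivAt_logRatio ht))).congr_of_eventuallyEq
    (Filter.Eventually.of_forall gfun_eq_log_add)
  refine h.congr_deriv ?_
  simp only [id]
  field_simp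
  ring

theorem continuous_gfun : Continuous gfun :=
  (Real.continuous_mul_log.comp (continuous_id.add continuous_const)).sub Real.continuous_mul_log

theorem gfun_strictMonoOn : StrictMonoOn gfun (Set.Ici 0) := by
  refine strictMonoOn_of_deriv_pos (convex_Ici 0) continuous_gfun.continuousOn fun t ht => ?_
  rw [interior_Ici] at ht
  rw [(hasDerivAt_gfun ht).deriv]
  exact logRatio_pos ht

theorem two_sub_lt_mul_exp_neg {k : ℝ} (hk : 0 < k) : 2 - k < (k + 2) * Real.exp (-k) := by
  have hd : ∀ x : ℝ, HasDerivAt (fun x : ℝ => (x + 2) * Real.exp (-x) + x)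
      (1 - (x + 1) * Real.exp (-x)) x := fun x => by
    have h := (((hasDerivAt_id x).add_const 2).mul (hasDerivAt_neg x).exp).add (hasDerivAt_id x)
    refine h.congr_deriv ?_
    simp only [id]
    ring
  have hmono : StrictMonoOn (fun x : ℝ => (x + 2) * Real.exp (-x) + x) (Set.Ici 0) := by
    refine strictMonoOn_of_deriv_pos (convex_Ici 0)
      (fun x _ => (hd x).continuousAt.continuousWithinAt) fun x hx => ?_
    rw [interior_Ici, Set.mem_Ioi] at hx
    have := mul_lt_mul_of_pos_right (Real.add_one_lt_exp hx.ne') (Real.exp_pos (-x))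
    rw [← Real.exp_add, add_neg_cancel, Real.exp_zero] at this
    rw [(hd x).deriv]
    linarith
  have := hmono Set.self_mem_Ici hk.le hk
  simp only [zero_add, neg_zero, Real.exp_zero] at this
  linarith

theorem two_lt_mul_logRatio {t : ℝ} (ht : 0 < t) : 2 < (2 * t + 1) * logRatio t := by
  have h := two_sub_lt_mul_exp_neg (logRatio_pos ht)
  rw [exp_neg_logRatio ht, ← mul_div_assoc, lt_div_iff₀ (by linarith)] at h
  linarith

theorem two_mul_logRatio_le {t : ℝ} (ht : 0 < t) :
    2 * logRatio t ≤ (2 * t + 1) / (t * (t + 1)) := by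
  have h := Real.self_le_sinh_iff.2 (logRatio_pos ht).le
  rw [Real.sinh_eq, exp_logRatio ht, exp_neg_logRatio ht] at h
  have : (2 * t + 1) / (t * (t + 1)) = (t + 1) / t - t / (t + 1) := by
    field_simp
    ring
  linarith

/-- A strengthened tangent line inequality for the exponential function. -/
theorem add_sq_le_mul_exp {M δ : ℝ} (hM : 0 ≤ M) (hδ : -M ≤ δ) :
    (M + 2) * (1 + δ) + δ ^ 2 ≤ (M + 2) * Real.exp δ := by
  rcases le_or_gt 0 δ with h | h
  · nlinarith [Real.quadratic_le_exp_of_nonneg h, mul_nonneg hM (sq_nonneg δ)]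
  · have h1 := two_sub_lt_mul_exp_neg (neg_pos.2 h)
    rw [neg_neg] at h1
    have h2 := Real.add_one_le_exp δ
    nlinarith [mul_nonneg (sub_nonneg.2 hδ) (sub_nonneg.2 h2)]

/-- The intercept at the origin of the tangent line, at `gfun t`, to the function `W` determined by
`W (gfun t) = t * (t + 1) * logRatio t ^ 2`; its slope is `(2 * t + 1) * logRatio t - 2`. -/
noncomputable def tangentIntercept (t : ℝ) : ℝ :=
  t * (t + 1) * logRatio t ^ 2 - ((2 * t + 1) * logRatio t - 2) * gfun t

theorem add_one_mul_exp_neg_le_gfun {t : ℝ} (ht : 0 < t) :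
    ((2 * t + 1) * logRatio t + 1) * Real.exp (-((2 * t + 1) * logRatio t)) ≤ gfun t := by
  have hL := logRatio_pos ht
  set L := logRatio t with hLdef
  have hdiff : 0 ≤ 2 * t * L := by positivity
  have h1 : ((2 * t + 1) * L + 1) * Real.exp (-((2 * t + 1) * L)) ≤ (L + 1) * Real.exp (-L) := by
    have e : Real.exp (-L) = Real.exp (2 * t * L) * Real.exp (-((2 * t + 1) * L)) := by
      rw [← Real.exp_add]; congr 1; ring
    rw [e, ← mul_assoc]
    refine mul_le_mul_of_nonneg_right ?_ (Real.exp_pos _).le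
    nlinarith [Real.add_one_le_exp (2 * t * L), mul_nonneg hL.le hdiff]
  refine h1.trans ?_
  rw [hLdef, exp_neg_logRatio ht, gfun_eq_log_add, ← hLdef]
  have h2 := Real.one_sub_inv_le_log_of_pos (show 0 < t + 1 by linarith)
  have h3 : (L + 1) * (t / (t + 1)) = L * (t / (t + 1)) + (1 - (t + 1)⁻¹) := by
    field_simp
    ring
  have h4 : t / (t + 1) ≤ t := div_le_self ht.le (by linarith)
  rw [h3]
  nlinarith [mul_le_mul_of_nonneg_left h4 hL.le]

open Filter Topology in
theorem tendsto_mul_logRatio : Tendsto (fun t => t * logRatio t) (𝓝[>] 0) (𝓝 0) := by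
  have h : Continuous fun t : ℝ => gfun t := continuous_gfun
  have h1 : Tendsto (fun t : ℝ => gfun t - Real.log (t + 1)) (𝓝[>] 0) (𝓝 0) := by
    have hl : Tendsto (fun t : ℝ => Real.log (t + 1)) (𝓝 0) (𝓝 0) := by
      have : ContinuousAt (fun t : ℝ => Real.log (t + 1)) 0 :=
        ContinuousAt.log (by fun_prop) (by norm_num)
      simpa [ContinuousAt] using this
    have := (h.tendsto 0).sub hl
    simp only [gfun, zero_add, Real.log_one, mul_zero, zero_mul, sub_zero] at this
    exact this.mono_left nhdsWithin_le_nhds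
  refine h1.congr fun t => ?_
  rw [gfun_eq_log_add]; ring

open Filter Topology in
theorem tendsto_mul_logRatio_sq : Tendsto (fun t => t * logRatio t ^ 2) (𝓝[>] 0) (𝓝 0) := by
  have hs : Tendsto (fun t : ℝ => 2 * (Real.sqrt t * Real.log (Real.sqrt t))) (𝓝[>] 0) (𝓝 0) := by
    have h := ((Real.continuous_mul_log.comp Real.continuous_sqrt).const_mul 2).tendsto 0
    simp only [Function.comp, Real.sqrt_zero, zero_mul, mul_zero] at h
    exact h.mono_left nhdsWithin_le_nhds
  have hl : Tendsto (fun t : ℝ => Real.sqrt t * Real.log (t + 1)) (𝓝[>] 0) (𝓝 0) := by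
    have : ContinuousAt (fun t : ℝ => Real.sqrt t * Real.log (t + 1)) 0 :=
      Real.continuous_sqrt.continuousAt.mul (ContinuousAt.log (by fun_prop) (by norm_num))
    have h2 := this.tendsto
    simp only [Real.sqrt_zero, zero_mul] at h2
    exact h2.mono_left nhdsWithin_le_nhds
  have h := (hl.sub hs).pow 2
  rw [sub_zero, zero_pow two_ne_zero] at h
  refine h.congr' ?_
  filter_upwards [self_mem_nhdsWithin] with t ht
  have ht' : (0 : ℝ) < t := ht
  rw [Real.log_sqrt ht'.le, logRatio]
  have := Real.sq_sqrt ht'.le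
  calc _ = (Real.sqrt t) ^ 2 * (Real.log (t + 1) - Real.log t) ^ 2 := by ring
    _ = _ := by rw [this]

open Filter Topology in
theorem add_two_mul_exp_neg_le_tangentIntercept {t : ℝ} (ht : 0 < t) :
    ((2 * t + 1) * logRatio t + 2) * Real.exp (-((2 * t + 1) * logRatio t)) ≤
      tangentIntercept t := by
  let Φ : ℝ → ℝ := fun s => tangentIntercept s -
    ((2 * s + 1) * logRatio s + 2) * Real.exp (-((2 * s + 1) * logRatio s))
  have hderiv : ∀ s : ℝ, 0 < s → HasDerivAt Φ
      (((2 * s + 1) / (s * (s + 1)) - 2 * logRatio s) * (gfun s -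
        ((2 * s + 1) * logRatio s + 1) * Real.exp (-((2 * s + 1) * logRatio s)))) s := by
    intro s hs
    have hL := hasDerivAt_logRatio hs
    have hid := hasDerivAt_id s
    have hM := ((hid.const_mul 2).add_const 1).mul hL
    have hw := (hid.mul (hid.add_const 1)).mul (hL.pow 2)
    have h := (hw.sub ((hM.sub_const 2).mul (hasDerivAt_gfun hs))).sub
      ((hM.add_const 2).mul hM.neg.exp)
    refine h.congr_deriv ?_
    simp only [id, Pi.mul_apply, Pi.pow_apply, Pi.neg_apply]
    field_simp
    ring
  have hmono : MonotoneOn Φ (Set.Ioi 0) := by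
    refine monotoneOn_of_deriv_nonneg (convex_Ioi 0)
      (fun s hs => (hderiv s hs).continuousAt.continuousWithinAt) ?_ ?_
    · rw [interior_Ioi]
      exact fun s hs => (hderiv s hs).differentiableAt.differentiableWithinAt
    · rw [interior_Ioi]
      intro s hs
      rw [(hderiv s hs).deriv]
      exact mul_nonneg (sub_nonneg.2 (two_mul_logRatio_le hs))
        (sub_nonneg.2 (add_one_mul_exp_neg_le_gfun hs))
  let Ψ : ℝ → ℝ := fun s => -((2 * s + 1) * (s * logRatio s + s * logRatio s ^ 2)
    + (s * logRatio s + 2 * s))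
  have hΨ : Tendsto Ψ (𝓝[>] 0) (𝓝 0) := by
    have hid : Tendsto (fun s : ℝ => s) (𝓝[>] 0) (𝓝 0) :=
      tendsto_id.mono_left nhdsWithin_le_nhds
    have := ((((hid.const_mul 2).add_const 1).mul
      (tendsto_mul_logRatio.add tendsto_mul_logRatio_sq)).add
      (tendsto_mul_logRatio.add (hid.const_mul 2))).neg
    simpa only [mul_zero, add_zero, neg_zero] using this
  have hle : ∀ s : ℝ, 0 < s → Ψ s ≤ Φ s := by
    intro s hs
    have hL := logRatio_pos hs
    have hM := two_lt_mul_logRatio hs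
    have hlog : Real.log (s + 1) ≤ s := by
      have := Real.log_le_sub_one_of_pos (show 0 < s + 1 by linarith)
      linarith
    have hg : ((2 * s + 1) * logRatio s - 2) * gfun s ≤
        (2 * s + 1) * (s * logRatio s + s * logRatio s ^ 2) := by
      have h1 : ((2 * s + 1) * logRatio s - 2) * gfun s ≤
          ((2 * s + 1) * logRatio s - 2) * (s + s * logRatio s) := by
        refine mul_le_mul_of_nonneg_left ?_ (by linarith)
        rw [gfun_eq_log_add]; linarith
      have h2 : 0 ≤ s + s * logRatio s := by positivity
      linarith
    have he : ((2 * s + 1) * logRatio s + 2) * Real.exp (-((2 * s + 1) * logRatio s)) ≤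
        s * logRatio s + 2 * s := by
      have e : Real.exp (-logRatio s) =
          Real.exp (2 * s * logRatio s) * Real.exp (-((2 * s + 1) * logRatio s)) := by
        rw [← Real.exp_add]; congr 1; ring
      have hdiff : 0 ≤ 2 * s * logRatio s := by positivity
      have h1 : ((2 * s + 1) * logRatio s + 2) * Real.exp (-((2 * s + 1) * logRatio s)) ≤
          (logRatio s + 2) * Real.exp (-logRatio s) := by
        rw [e, ← mul_assoc]
        refine mul_le_mul_of_nonneg_right ?_ (Real.exp_pos _).le
        nlinarith [Real.add_one_le_exp (2 * s * logRatio s), mul_nonneg hL.le hdiff]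
      rw [exp_neg_logRatio hs] at h1
      have h2 : s / (s + 1) ≤ s := div_le_self hs.le (by linarith)
      nlinarith [mul_le_mul_of_nonneg_left h2 (show 0 ≤ logRatio s + 2 by linarith)]
    have hw : 0 ≤ s * (s + 1) * logRatio s ^ 2 := by positivity
    simp only [Ψ, Φ, tangentIntercept]
    linarith
  have hev : ∀ᶠ s in 𝓝[>] (0 : ℝ), Ψ s ≤ Φ t := by
    filter_upwards [Ioo_mem_nhdsGT ht] with s hs
    exact (hle s hs.1).trans (hmono hs.1 ht hs.2.le)
  exact sub_nonneg.1 (le_of_tendsto hΨ hev)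

theorem tangentIntercept_nonneg {t : ℝ} (ht : 0 < t) : 0 ≤ tangentIntercept t := by
  refine le_trans ?_ (add_two_mul_exp_neg_le_tangentIntercept ht)
  have := two_lt_mul_logRatio ht
  have := Real.exp_pos (-((2 * t + 1) * logRatio t))
  positivity

theorem exp_neg_mul_sq_le {t y : ℝ} (ht : 0 < t) (hy : 0 ≤ y) :
    Real.exp (-y) * y ^ 2 ≤ tangentIntercept t +
      ((2 * t + 1) * logRatio t - 2) * (Real.exp (-y) * (1 + y)) := by
  have hM := two_lt_mul_logRatio ht
  have h0 := add_two_mul_exp_neg_le_tangentIntercept ht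
  set M := (2 * t + 1) * logRatio t
  have h1 := add_sq_le_mul_exp (M := M) (δ := y - M) (by linarith) (by linarith)
  have e : Real.exp (-M) = Real.exp (y - M) * Real.exp (-y) := by
    rw [← Real.exp_add]; congr 1; ring
  have h2 := mul_le_mul_of_nonneg_right h1 (Real.exp_pos (-y)).le
  rw [mul_assoc, ← e] at h2
  nlinarith

/-- The pointwise estimate behind the variance bound, for a weight `x` not exceeding `κ ≤ 1`. -/
theorem mul_log_sub_sq_le {t x κ : ℝ} (ht : 0 < t) (hx : 0 ≤ x) (hxκ : x ≤ κ) (hκ : κ ≤ 1) :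
    x * (Real.log κ - Real.log x) ^ 2 ≤ tangentIntercept t +
      ((2 * t + 1) * logRatio t - 2) * (x + x * (Real.log κ - Real.log x)) := by
  have hT := tangentIntercept_nonneg ht
  rcases hx.eq_or_lt with rfl | hx
  · simpa using hT
  have hκ0 : 0 < κ := hx.trans_le hxκ
  have hy : 0 ≤ Real.log κ - Real.log x := sub_nonneg.2 (Real.log_le_log hx hxκ)
  have h := mul_le_mul_of_nonneg_left (exp_neg_mul_sq_le ht hy) hκ0.le
  have e : κ * Real.exp (-(Real.log κ - Real.log x)) = x := by
    rw [neg_sub, Real.exp_sub, Real.exp_log hx, Real.exp_log hκ0]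
    field_simp
  set y := Real.log κ - Real.log x
  have h2 : κ * tangentIntercept t ≤ tangentIntercept t := mul_le_of_le_one_left hT hκ
  calc x * y ^ 2 = κ * (Real.exp (-y) * y ^ 2) := by rw [← e]; ring
    _ ≤ _ := h
    _ = κ * tangentIntercept t +
        ((2 * t + 1) * logRatio t - 2) * (κ * Real.exp (-y) * (1 + y)) := by ring
    _ ≤ _ := by rw [e]; linarith

section Classical

variable {ι : Type*} [Fintype ι]

/-- For a probability vector `P` with largest entry `P j`, the entropy of `P` controls the second
moment of `log P` about `log (P j)`. -/
theorem mul_sum_log_sub_sq_lt {P : ι → ℝ} (hP : ∀ i, 0 ≤ P i) (hsum : ∑ i, P i = 1) {j : ι}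
    (hj : ∀ i, P i ≤ P j) {c t : ℝ} (hc : 0 ≤ c) (hcard : c * ((Fintype.card ι : ℝ) - 1) ≤ 1)
    (ht : 0 < t) (hH : c * ∑ i, Real.negMulLog (P i) < gfun t) :
    c * ∑ i, P i * (Real.log (P i) - Real.log (P j)) ^ 2 < t * (t + 1) * logRatio t ^ 2 := by
  classical
  have hj1 : P j ≤ 1 := hsum ▸ Finset.single_le_sum (fun i _ => hP i) (Finset.mem_univ j)
  have hj0 : 0 < P j := by
    by_contra h
    have : ∑ i, P i ≤ 0 := Finset.sum_nonpos fun i _ => (hj i).trans (not_lt.1 h)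
    linarith
  have hα := two_lt_mul_logRatio ht
  have hT := tangentIntercept_nonneg ht
  have hw : t * (t + 1) * logRatio t ^ 2 =
      tangentIntercept t + ((2 * t + 1) * logRatio t - 2) * gfun t := by
    rw [tangentIntercept]; ring
  set α := (2 * t + 1) * logRatio t - 2
  let y : ι → ℝ := fun i => Real.log (P j) - Real.log (P i)
  have hXy : ∑ i ∈ Finset.univ.erase j, (P i + P i * y i) ≤ ∑ i, Real.negMulLog (P i) := by
    have h1 : ∑ i, Real.negMulLog (P i) = -Real.log (P j) + ∑ i, P i * y i := by
      have : ∀ i, Real.negMulLog (P i) = -(P i * Real.log (P j)) + P i * y i := fun i => by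
        simp only [Real.negMulLog, y]; ring
      simp only [this, Finset.sum_add_distrib, Finset.sum_neg_distrib, ← Finset.sum_mul, hsum,
        one_mul]
    have h2 := Finset.add_sum_erase Finset.univ P (Finset.mem_univ j)
    have h3 := Finset.add_sum_erase Finset.univ (fun i => P i * y i) (Finset.mem_univ j)
    have h4 : P j * y j = 0 := by simp [y]
    have h5 := Real.log_le_sub_one_of_pos hj0
    rw [Finset.sum_add_distrib]
    linarith
  have hV : ∑ i, P i * (Real.log (P i) - Real.log (P j)) ^ 2 ≤
      ((Fintype.card ι : ℝ) - 1) * tangentIntercept t + α * ∑ i, Real.negMulLog (P i) := by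
    rw [← Finset.add_sum_erase Finset.univ _ (Finset.mem_univ j)]
    have h1 : ∑ i ∈ Finset.univ.erase j, P i * (Real.log (P i) - Real.log (P j)) ^ 2 ≤
        ∑ i ∈ Finset.univ.erase j, (tangentIntercept t + α * (P i + P i * y i)) := by
      refine Finset.sum_le_sum fun i _ => ?_
      rw [sub_sq_comm]
      exact mul_log_sub_sq_le ht (hP i) (hj i) hj1
    rw [Finset.sum_add_distrib, Finset.sum_const, ← Finset.mul_sum, nsmul_eq_mul,
      Finset.cast_card_erase_of_mem (Finset.mem_univ j), Finset.card_univ] at h1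
    have h2 := mul_le_mul_of_nonneg_left hXy (show 0 ≤ α by simp only [α]; linarith)
    simp only [sub_self, zero_pow two_ne_zero, mul_zero, zero_add]
    linarith
  have h1 := mul_le_mul_of_nonneg_left hV hc
  have h2 := mul_le_mul_of_nonneg_right hcard hT
  have h3 := mul_lt_mul_of_pos_left hH (show 0 < α by simp only [α]; linarith)
  rw [hw]
  linarith

/-- A point with negative second derivative is not a local minimum. -/
theorem not_isLocalMin_of_hasDerivAt_neg {f f' : ℝ → ℝ} {x f'' : ℝ}
    (hf : ∀ᶠ y in nhds x, HasDerivAt f (f' y) y) (hf' : HasDerivAt f' f'' x) (hneg : f'' < 0) :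
    ¬ IsLocalMin f x := by
  intro hmin
  have hd : deriv f =ᶠ[nhds x] f' := hf.mono fun y hy => hy.deriv
  have hdd : deriv (deriv f) x = f'' := by rw [hd.deriv_eq, hf'.deriv]
  have hmax : IsLocalMax f x := isLocalMax_of_deriv_deriv_neg (by rw [hdd]; exact hneg)
    hmin.deriv_eq_zero hf.self_of_nhds.continuousAt
  have hconst : f =ᶠ[nhds x] fun _ => f x := by
    filter_upwards [hmin, hmax] with y h1 h2 using le_antisymm h2 h1
  have h0 : deriv f =ᶠ[nhds x] fun _ => 0 := by
    simpa using hconst.deriv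
  rw [h0.deriv_eq, deriv_const] at hdd
  exact hneg.ne hdd.symm

theorem segment_pos_or_eq_zero {a b : ℝ} (ha : 0 ≤ a) (hb : 0 ≤ b) :
    (∀ s ∈ Set.Ioo (0 : ℝ) 1, 0 < s * a + (1 - s) * b) ∨ a = 0 ∧ b = 0 := by
  rcases ha.eq_or_lt with rfl | ha'
  · rcases hb.eq_or_lt with rfl | hb'
    · exact Or.inr ⟨rfl, rfl⟩
    · exact Or.inl fun s hs => by simpa using mul_pos (sub_pos.2 hs.2) hb'
  · exact Or.inl fun s hs =>
      add_pos_of_pos_of_nonneg (mul_pos hs.1 ha') (mul_nonneg (sub_nonneg.2 hs.2.le) hb)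

theorem hasDerivAt_segment (a b s : ℝ) :
    HasDerivAt (fun s : ℝ => s * a + (1 - s) * b) (a - b) s := by
  refine (((hasDerivAt_id s).mul_const a).add
    (((hasDerivAt_id s).const_sub 1).mul_const b)).congr_deriv ?_
  ring

theorem hasDerivAt_negMulLog_segment {a b s : ℝ} (ha : 0 ≤ a) (hb : 0 ≤ b)
    (hs : s ∈ Set.Ioo (0 : ℝ) 1) :
    HasDerivAt (fun s : ℝ => Real.negMulLog (s * a + (1 - s) * b))
      ((a - b) * (-Real.log (s * a + (1 - s) * b) - 1)) s := by
  rcases segment_pos_or_eq_zero ha hb with h | ⟨rfl, rfl⟩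
  · rw [mul_comm]
    exact (Real.hasDerivAt_negMulLog (h s hs).ne').comp s (hasDerivAt_segment a b s)
  · simpa using hasDerivAt_const s (0 : ℝ)

theorem hasDerivAt_log_segment {a b s : ℝ} (ha : 0 ≤ a) (hb : 0 ≤ b)
    (hs : s ∈ Set.Ioo (0 : ℝ) 1) :
    HasDerivAt (fun s : ℝ => (a - b) * (-Real.log (s * a + (1 - s) * b) - 1))
      (-((a - b) ^ 2 / (s * a + (1 - s) * b))) s := by
  rcases segment_pos_or_eq_zero ha hb with h | ⟨rfl, rfl⟩
  · refine ((((hasDerivAt_segment a b s).log (h s hs).ne').neg.sub_const 1).const_mul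
      (a - b)).congr_deriv ?_
    ring
  · simpa using hasDerivAt_const s (0 : ℝ)

/-- Concavity of the entropy photon number of probability vectors, stated without the inverse
of `gfun`. -/
theorem gfun_segment_le {a b : ι → ℝ} (ha : ∀ i, 0 ≤ a i) (hb : ∀ i, 0 ≤ b i)
    (hasum : ∑ i, a i = 1) (hbsum : ∑ i, b i = 1) {c : ℝ} (hc : 0 ≤ c)
    (hcard : c * ((Fintype.card ι : ℝ) - 1) ≤ 1) {x y : ℝ} (hx : 0 ≤ x) (hy : 0 ≤ y)
    (hgx : gfun x ≤ c * ∑ i, Real.negMulLog (a i)) (hgy : gfun y ≤ c * ∑ i, Real.negMulLog (b i))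
    {p : ℝ} (hp : p ∈ Set.Icc (0 : ℝ) 1) :
    gfun (p * x + (1 - p) * y) ≤ c * ∑ i, Real.negMulLog (p * a i + (1 - p) * b i) := by
  rcases eq_or_ne x y with rfl | hxy
  · have hconc : ∑ i, (p * Real.negMulLog (a i) + (1 - p) * Real.negMulLog (b i)) ≤
        ∑ i, Real.negMulLog (p * a i + (1 - p) * b i) := Finset.sum_le_sum fun i _ =>
      Real.concaveOn_negMulLog.2 (ha i) (hb i) hp.1 (sub_nonneg.2 hp.2) (by ring)
    rw [Finset.sum_add_distrib, ← Finset.mul_sum, ← Finset.mul_sum] at hconc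
    have h1 := mul_le_mul_of_nonneg_left hconc hc
    have h2 := mul_le_mul_of_nonneg_left hgx hp.1
    have h3 := mul_le_mul_of_nonneg_left hgy (sub_nonneg.2 hp.2)
    rw [← add_mul, add_sub_cancel, one_mul]
    linarith
  have hl0 : ∀ s ∈ Set.Ioo (0 : ℝ) 1, 0 < s * x + (1 - s) * y :=
    (segment_pos_or_eq_zero hx hy).resolve_right fun h => hxy (h.1.trans h.2.symm)
  let D : ℝ → ℝ := fun s =>
    c * ∑ i, Real.negMulLog (s * a i + (1 - s) * b i) - gfun (s * x + (1 - s) * y)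
  have hDcont : Continuous D := by
    refine (continuous_const.mul (continuous_finsetSum _ fun i _ => ?_)).sub ?_
    · exact Real.continuous_negMulLog.comp (by fun_prop)
    · exact continuous_gfun.comp (by fun_prop)
  obtain ⟨s, hs, hsmin⟩ := isCompact_Icc.exists_isMinOn ⟨p, hp⟩ hDcont.continuousOn
  suffices h : 0 ≤ D s from sub_nonneg.1 (h.trans (hsmin hp))
  by_contra! hneg
  have hs' : s ∈ Set.Ioo (0 : ℝ) 1 := by
    refine ⟨hs.1.lt_of_ne ?_, hs.2.lt_of_ne ?_⟩
    · rintro rfl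
      simp only [D, zero_mul, sub_zero, one_mul, zero_add] at hneg
      linarith
    · rintro rfl
      simp only [D, one_mul, sub_self, zero_mul, add_zero] at hneg
      linarith
  have hlocmin : IsLocalMin D s := hsmin.isLocalMin (Icc_mem_nhds hs'.1 hs'.2)
  let D' : ℝ → ℝ := fun s =>
    c * ∑ i, (a i - b i) * (-Real.log (s * a i + (1 - s) * b i) - 1) -
      logRatio (s * x + (1 - s) * y) * (x - y)
  have hD : ∀ r ∈ Set.Ioo (0 : ℝ) 1, HasDerivAt D (D' r) r := fun r hr => by
    have hg := (hasDerivAt_gfun (hl0 r hr)).comp r (hasDerivAt_segment x y r)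
    exact ((HasDerivAt.fun_sum fun i _ =>
      hasDerivAt_negMulLog_segment (ha i) (hb i) hr).const_mul c).sub hg
  have hcrit : D' s = 0 := hlocmin.hasDerivAt_eq_zero (hD s hs')
  have hD' := ((HasDerivAt.fun_sum (u := Finset.univ) fun i _ =>
    hasDerivAt_log_segment (ha i) (hb i) hs').const_mul c).sub
      (((hasDerivAt_logRatio (hl0 s hs')).comp s (hasDerivAt_segment x y s)).mul_const (x - y))
  refine not_isLocalMin_of_hasDerivAt_neg
    (Filter.eventually_of_mem (Ioo_mem_nhds hs'.1 hs'.2) hD) hD' ?_ hlocmin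
  set P : ι → ℝ := fun i => s * a i + (1 - s) * b i with hPdef
  have hP : ∀ i, 0 ≤ P i := fun i =>
    add_nonneg (mul_nonneg hs.1 (ha i)) (mul_nonneg (sub_nonneg.2 hs.2) (hb i))
  have hPsum : ∑ i, P i = 1 := by
    simp only [hPdef, Finset.sum_add_distrib, ← Finset.mul_sum, hasum, hbsum]
    ring
  have hne : Nonempty ι := by
    by_contra h
    rw [not_nonempty_iff] at h
    simp at hPsum
  obtain ⟨j, hj⟩ := Finite.exists_max P
  have hl := hl0 s hs'
  have hV := mul_sum_log_sub_sq_lt hP hPsum hj hc hcard hl (sub_neg.1 hneg)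
  have hLpos := logRatio_pos hl
  have hH' : ∑ i, (a i - b i) * (-Real.log (P i) - 1) =
      -∑ i, (a i - b i) * (Real.log (P i) - Real.log (P j)) := by
    have h0 : ∑ i, (a i - b i) * (Real.log (P j) + 1) = 0 := by
      rw [← Finset.sum_mul, Finset.sum_sub_distrib, hasum, hbsum, sub_self, zero_mul]
    rw [← sub_zero (-_), ← h0, ← Finset.sum_neg_distrib, ← Finset.sum_sub_distrib]
    exact Finset.sum_congr rfl fun i _ => by ring
  have hCS : (∑ i, (a i - b i) * (Real.log (P i) - Real.log (P j))) ^ 2 ≤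
      (∑ i, (a i - b i) ^ 2 / P i) * ∑ i, P i * (Real.log (P i) - Real.log (P j)) ^ 2 := by
    refine Finset.sum_sq_le_sum_mul_sum_of_sq_le_mul _
      (fun i _ => div_nonneg (sq_nonneg _) (hP i)) (fun i _ => mul_nonneg (hP i) (sq_nonneg _))
      fun i _ => le_of_eq ?_
    rcases segment_pos_or_eq_zero (ha i) (hb i) with h | ⟨h1, h2⟩
    · have : P i ≠ 0 := (h s hs').ne'
      field_simp
    · simp [h1, h2]
  change c * ∑ i, (a i - b i) * (-Real.log (P i) - 1) - _ = 0 at hcrit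
  change c * ∑ i, -((a i - b i) ^ 2 / P i) - _ < 0
  rw [hH'] at hcrit
  rw [Finset.sum_neg_distrib]
  set l := s * x + (1 - s) * y
  set V := ∑ i, P i * (Real.log (P i) - Real.log (P j)) ^ 2
  set K := ∑ i, (a i - b i) ^ 2 / P i
  set S := ∑ i, (a i - b i) * (Real.log (P i) - Real.log (P j))
  have hK : 0 ≤ K := Finset.sum_nonneg fun i _ => div_nonneg (sq_nonneg _) (hP i)
  have hxy2 : 0 < (x - y) ^ 2 := by
    have := sub_ne_zero.2 hxy
    positivity
  have h1 : logRatio l ^ 2 * (x - y) ^ 2 ≤ c * V * (c * K) := by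
    have e : logRatio l * (x - y) = -(c * S) := by linarith
    rw [← mul_pow, e]
    nlinarith [mul_le_mul_of_nonneg_left hCS (sq_nonneg c)]
  have hcK : 0 < c * K := by
    refine (mul_nonneg hc hK).lt_of_ne fun h => ?_
    rw [← h, mul_zero] at h1
    have : 0 < logRatio l ^ 2 * (x - y) ^ 2 := by positivity
    linarith
  have h2 : logRatio l ^ 2 * (x - y) ^ 2 < logRatio l ^ 2 * (l * (l + 1) * (c * K)) := by
    nlinarith [mul_lt_mul_of_pos_right hV hcK]
  have h3 : (x - y) ^ 2 < l * (l + 1) * (c * K) := lt_of_mul_lt_mul_left h2 (by positivity)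
  have h4 : (x - y) ^ 2 / (l * (l + 1)) < c * K := by
    rw [div_lt_iff₀ (by positivity)]
    linarith
  have h5 : -(1 / (l * (l + 1))) * (x - y) * (x - y) = -((x - y) ^ 2 / (l * (l + 1))) := by ring
  rw [h5]
  linarith

end Classical

section Quantum

variable {n : Type*} [Fintype n]

/-- The real part of the quadratic form of `A` at `v`. -/
noncomputable def expectation (A : Matrix n n ℂ) (v : EuclideanSpace ℂ n) : ℝ :=
  (star (v : n → ℂ) ⬝ᵥ (A *ᵥ (v : n → ℂ))).re

theorem expectation_nonneg {A : Matrix n n ℂ} (hA : A.PosSemidef) (v : EuclideanSpace ℂ n) :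
    0 ≤ expectation A v :=
  hA.re_dotProduct_nonneg _

theorem expectation_smul_add_smul (A B : Matrix n n ℂ) (p q : ℝ) (v : EuclideanSpace ℂ n) :
    expectation ((p : ℂ) • A + (q : ℂ) • B) v = p * expectation A v + q * expectation B v := by
  simp [expectation, add_mulVec, smul_mulVec, dotProduct_add, dotProduct_smul]

variable [DecidableEq n]

theorem expectation_eq_sum {A : Matrix n n ℂ} (hA : A.IsHermitian) (v : EuclideanSpace ℂ n) :
    expectation A v = ∑ j, ‖inner ℂ (hA.eigenvectorBasis j) v‖ ^ 2 * hA.eigenvalues j := by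
  have hAv : A *ᵥ (v : n → ℂ) = ∑ j, (inner ℂ (hA.eigenvectorBasis j) v) •
      (hA.eigenvalues j • ((hA.eigenvectorBasis j : EuclideanSpace ℂ n) : n → ℂ)) := by
    conv_lhs => rw [← hA.eigenvectorBasis.sum_repr' v]
    rw [WithLp.ofLp_sum, mulVec_sum]
    exact Finset.sum_congr rfl fun j _ => by
      rw [WithLp.ofLp_smul, mulVec_smul, hA.mulVec_eigenvectorBasis]
  rw [expectation, hAv, dotProduct_sum, Complex.re_sum]
  refine Finset.sum_congr rfl fun j _ => ?_
  rw [dotProduct_smul, dotProduct_smul, dotProduct_comm, ← EuclideanSpace.inner_eq_star_dotProduct,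
    ← inner_conj_symm v, smul_eq_mul, mul_smul_comm, Complex.mul_conj, Complex.normSq_eq_norm_sq,
    Complex.smul_re, Complex.ofReal_re, smul_eq_mul, mul_comm]

theorem sum_expectation {A : Matrix n n ℂ} (hA : A.IsHermitian)
    (u : OrthonormalBasis n ℂ (EuclideanSpace ℂ n)) :
    ∑ i, expectation A (u i) = ∑ j, hA.eigenvalues j := by
  simp only [expectation_eq_sum hA]
  rw [Finset.sum_comm]
  refine Finset.sum_congr rfl fun j _ => ?_
  rw [← Finset.sum_mul, u.sum_sq_norm_inner_left, hA.eigenvectorBasis.orthonormal.1 j]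
  ring

/-- Measuring in an orthonormal basis does not decrease the entropy. -/
theorem sum_negMulLog_eigenvalues_le {A : Matrix n n ℂ} (hA : A.PosSemidef)
    (u : OrthonormalBasis n ℂ (EuclideanSpace ℂ n)) :
    ∑ j, Real.negMulLog (hA.1.eigenvalues j) ≤ ∑ i, Real.negMulLog (expectation A (u i)) := by
  have hrow : ∀ j, ∑ i, ‖inner ℂ (hA.1.eigenvectorBasis j) (u i)‖ ^ 2 = 1 := fun j => by
    rw [u.sum_sq_norm_inner_left, hA.1.eigenvectorBasis.orthonormal.1 j, one_pow]
  have hcol : ∀ i, ∑ j, ‖inner ℂ (hA.1.eigenvectorBasis j) (u i)‖ ^ 2 = 1 := fun i => by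
    rw [hA.1.eigenvectorBasis.sum_sq_norm_inner_right, u.orthonormal.1 i, one_pow]
  calc ∑ j, Real.negMulLog (hA.1.eigenvalues j)
      = ∑ i, ∑ j, ‖inner ℂ (hA.1.eigenvectorBasis j) (u i)‖ ^ 2 *
          Real.negMulLog (hA.1.eigenvalues j) := by
        rw [Finset.sum_comm]
        exact Finset.sum_congr rfl fun j _ => by rw [← Finset.sum_mul, hrow, one_mul]
    _ ≤ _ := Finset.sum_le_sum fun i _ => by
        rw [expectation_eq_sum hA.1]
        exact Real.concaveOn_negMulLog.le_map_sum (fun _ _ => sq_nonneg _) (hcol i)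
          fun j _ => hA.eigenvalues_nonneg j

end Quantum

theorem vnEntropy_eq {d : ℕ} {ρ : Matrix (Fin d) (Fin d) ℂ} (h : ρ.IsHermitian) :
    vnEntropy ρ = ∑ i, Real.negMulLog (h.eigenvalues i) := by
  rw [vnEntropy, dif_pos h]

theorem sum_expectation_eq_one {d : ℕ} {ρ : Matrix (Fin d) (Fin d) ℂ} (h : ρ.IsHermitian)
    (htr : ρ.trace = 1) (u : OrthonormalBasis (Fin d) ℂ (EuclideanSpace ℂ (Fin d))) :
    ∑ i, expectation ρ (u i) = 1 := by
  rw [sum_expectation h]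
  have := congrArg Complex.re h.trace_eq_sum_eigenvalues
  simpa [htr] using this.symm

end EntropyPhotonNumber

open EntropyPhotonNumber in
theorem stmt_14 (d : ℕ) (hd : 2 ≤ d) (c : ℝ)
    (hc : 0 ≤ c ∧ c ≤ 1 / ((d : ℝ) - 1))
    (ρ σ : Matrix (Fin d) (Fin d) ℂ)
    (hρ : ρ.PosSemidef) (hρtr : ρ.trace = 1)
    (hσ : σ.PosSemidef) (hσtr : σ.trace = 1)
    (p : ℝ) (hp : p ∈ Set.Icc (0:ℝ) 1)
    -- n₁ = g⁻¹(c H(ρ)), n₂ = g⁻¹(c H(σ)), n = g⁻¹(c H(pρ + (1-p)σ))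
    (n₁ n₂ n : ℝ) (hn₁ : 0 ≤ n₁) (hn₂ : 0 ≤ n₂) (hn : 0 ≤ n)
    (hg₁ : gfun n₁ = c * vnEntropy ρ) (hg₂ : gfun n₂ = c * vnEntropy σ)
    (hg : gfun n = c * vnEntropy ((p : ℂ) • ρ + ((1 - p : ℝ) : ℂ) • σ)) :
    n ≥ p * n₁ + (1 - p) * n₂ := by
  have hp' : 0 ≤ 1 - p := sub_nonneg.2 hp.2
  have hτ : ((p : ℂ) • ρ + ((1 - p : ℝ) : ℂ) • σ).PosSemidef :=
    (hρ.smul (by exact_mod_cast hp.1)).add (hσ.smul (by exact_mod_cast hp'))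
  let u := hτ.1.eigenvectorBasis
  have hd' : (0 : ℝ) < (d : ℝ) - 1 := by
    have : (2 : ℝ) ≤ d := by exact_mod_cast hd
    linarith
  have hcard : c * ((Fintype.card (Fin d) : ℝ) - 1) ≤ 1 := by
    rw [Fintype.card_fin]
    exact (le_div_iff₀ hd').1 hc.2
  have h := gfun_segment_le (fun i => expectation_nonneg hρ (u i))
    (fun i => expectation_nonneg hσ (u i)) (sum_expectation_eq_one hρ.1 hρtr u)
    (sum_expectation_eq_one hσ.1 hσtr u) hc.1 hcard hn₁ hn₂
    (by
      rw [hg₁, vnEntropy_eq hρ.1]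
      exact mul_le_mul_of_nonneg_left (sum_negMulLog_eigenvalues_le hρ u) hc.1)
    (by
      rw [hg₂, vnEntropy_eq hσ.1]
      exact mul_le_mul_of_nonneg_left (sum_negMulLog_eigenvalues_le hσ u) hc.1) hp
  have heig : ∀ i, p * expectation ρ (u i) + (1 - p) * expectation σ (u i) =
      hτ.1.eigenvalues i := fun i => by
    rw [← expectation_smul_add_smul, hτ.1.eigenvalues_eq]
    rfl
  simp only [heig] at h
  rw [← vnEntropy_eq hτ.1, ← hg] at h
  exact (gfun_strictMonoOn.le_iff_le
    (add_nonneg (mul_nonneg hp.1 hn₁) (mul_nonneg hp' hn₂)) hn).1 h
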